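/- arXiv:1002.1679 — 2 statements merged into one kernel-verified Lean document; each statement's English description precedes it below -/
import Mathlib

section
/- The intersection of the Fibonacci numbers and the Lucas numbers is {1, 2, 3}; that is, {U_n(1,-1) : n >= 0} ∩ {V_m(1,-1) : m >= 0} = {1, 2, 3}. -/
/-- Lucas sequence of the first kind: `U 0 = 0`, `U 1 = 1`,
`U (n+2) = P * U (n+1) - Q * U n`. -/
def lucasU (P Q : ℤ) : ℕ → ℤ
  | 0 => 0
  | 1 => 1
  | n + 2 => P * lucasU P Q (n + 1) - Q * lucasU P Q n

/-- Lucas sequence of the second kind: `V 0 = 2`, `V 1 = P`,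
`V (n+2) = P * V (n+1) - Q * V n`. -/
def lucasV (P Q : ℤ) : ℕ → ℤ
  | 0 => 2
  | 1 => P
  | n + 2 => P * lucasV P Q (n + 1) - Q * lucasV P Q n

theorem lucasU_one_neg_one (n : ℕ) : lucasU 1 (-1) n = (Nat.fib n : ℤ) := by
  induction n using Nat.twoStepInduction with
  | zero => rfl
  | one => rfl
  | more n h₀ h₁ => rw [lucasU, h₀, h₁, Nat.fib_add_two]; push_cast; ring

theorem lucasV_one_neg_one_succ (m : ℕ) :
    lucasV 1 (-1) (m + 1) = (Nat.fib m + Nat.fib (m + 2) : ℤ) := by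
  induction m using Nat.twoStepInduction with
  | zero => rfl
  | one => rfl
  | more m h₀ h₁ =>
    rw [lucasV, h₀, h₁, Nat.fib_add_two (n := m + 2), Nat.fib_add_two (n := m + 1),
      Nat.fib_add_two (n := m)]
    push_cast
    ring

/-- From index `3` on, a Lucas number lies strictly between two consecutive Fibonacci numbers. -/
theorem fib_ne_fib_add_fib (m n : ℕ) : Nat.fib n ≠ Nat.fib (m + 2) + Nat.fib (m + 4) := by
  have hpos : 0 < Nat.fib (m + 2) := Nat.fib_pos.2 (by omega)
  have hlt : Nat.fib (m + 2) < Nat.fib (m + 3) := Nat.fib_lt_fib_succ (by omega)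
  have hadd : Nat.fib (m + 5) = Nat.fib (m + 3) + Nat.fib (m + 4) := Nat.fib_add_two
  rcases Nat.lt_or_ge n (m + 5) with h | h
  · have := Nat.fib_mono (show n ≤ m + 4 by omega)
    omega
  · have := Nat.fib_mono h
    omega

theorem fibonacci_inter_lucas :
    {x : ℤ | ∃ n : ℕ, x = lucasU 1 (-1) n} ∩ {x : ℤ | ∃ m : ℕ, x = lucasV 1 (-1) m} =
      ({1, 2, 3} : Set ℤ) := by
  ext x
  simp only [Set.mem_inter_iff, Set.mem_ofPred_eq, Set.mem_insert_iff, Set.mem_singleton_iff]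
  constructor
  · rintro ⟨⟨n, hn⟩, m, hm⟩
    match m with
    | 0 => exact Or.inr (Or.inl hm)
    | 1 => exact Or.inl hm
    | 2 => exact Or.inr (Or.inr hm)
    | m + 3 =>
      rw [hn, lucasU_one_neg_one, lucasV_one_neg_one_succ] at hm
      exact absurd (by exact_mod_cast hm) (fib_ne_fib_add_fib m n)
  · rintro (rfl | rfl | rfl)
    · exact ⟨⟨1, rfl⟩, 1, rfl⟩
    · exact ⟨⟨3, rfl⟩, 0, rfl⟩
    · exact ⟨⟨4, rfl⟩, 2, rfl⟩
end

section
/- The intersection of the Pell numbers and the Lucas numbers is {1, 2, 29}; that is, {U_n(2,-1) : n >= 0} ∩ {V_m(1,-1) : m >= 0} = {1, 2, 29}. -/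
/-! ### Identities for the Lucas sequences with `Q = -1` -/

theorem lucasU_norm (P : ℤ) (n : ℕ) :
    lucasU P (-1) (n + 1) ^ 2 - P * lucasU P (-1) (n + 1) * lucasU P (-1) n
      - lucasU P (-1) n ^ 2 = (-1) ^ n := by
  induction n with
  | zero => simp [lucasU]
  | succ n ih =>
    rw [pow_succ (-1 : ℤ) n, ← ih]
    simp only [lucasU]
    ring

theorem lucasV_eq_lucasU (P : ℤ) (n : ℕ) :
    lucasV P (-1) n = 2 * lucasU P (-1) (n + 1) - P * lucasU P (-1) n := by
  induction n using Nat.twoStepInduction with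
  | zero => simp [lucasU, lucasV]
  | one => simp [lucasU, lucasV]; ring
  | more n h0 h1 =>
    simp only [lucasU, lucasV] at *
    rw [h0, h1]
    ring

theorem lucasV_sq_sub (P : ℤ) (n : ℕ) :
    lucasV P (-1) n ^ 2 - (P ^ 2 + 4) * lucasU P (-1) n ^ 2 = 4 * (-1) ^ n := by
  rw [lucasV_eq_lucasU, ← lucasU_norm P n]
  ring

theorem lucasV_add_mul (P : ℤ) (x d : ℕ) :
    lucasV P (-1) (2 * x + d) + (-1) ^ x * lucasV P (-1) d =
      lucasV P (-1) (x + d) * lucasV P (-1) x := by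
  induction x using Nat.twoStepInduction generalizing d with
  | zero => simp [lucasV]; ring
  | one =>
    rw [show 2 * 1 + d = d + 2 by ring, add_comm 1 d]
    simp only [lucasV]
    ring
  | more x h0 h1 =>
    have e0 := h0 (d + 2)
    have e1 := h1 (d + 1)
    rw [show 2 * x + (d + 2) = 2 * x + d + 2 by ring,
      show x + (d + 2) = x + d + 2 by ring] at e0
    rw [show 2 * (x + 1) + (d + 1) = 2 * x + d + 3 by ring,
      show x + 1 + (d + 1) = x + d + 2 by ring] at e1
    rw [show 2 * (x + 2) + d = 2 * x + d + 4 by ring,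
      show x + 2 + d = x + d + 2 by ring]
    have r1 : lucasV P (-1) (2 * x + d + 4) =
      P * lucasV P (-1) (2 * x + d + 3) - (-1) * lucasV P (-1) (2 * x + d + 2) := rfl
    have r2 : lucasV P (-1) (x + 2) =
      P * lucasV P (-1) (x + 1) - (-1) * lucasV P (-1) x := rfl
    have r3 : lucasV P (-1) (d + 2) =
      P * lucasV P (-1) (d + 1) - (-1) * lucasV P (-1) d := rfl
    rw [r1, r2]
    rw [r3] at e0
    rw [pow_succ] at e1
    rw [pow_add]
    linear_combination e0 + P * e1

theorem lucasV_two_mul (P : ℤ) (n : ℕ) :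
    lucasV P (-1) (2 * n) = lucasV P (-1) n ^ 2 - 2 * (-1) ^ n := by
  have h := lucasV_add_mul P n 0
  simp only [add_zero, lucasV] at h
  linear_combination h

/-! ### Sign changes modulo `lucasV P (-1) k` -/

theorem lucasV_dvd_add {P : ℤ} {k u : ℕ} (hk : Even k) (hu : Odd u) (d : ℕ) :
    lucasV P (-1) k ∣ lucasV P (-1) (2 * k * u + d) + lucasV P (-1) d := by
  have step : ∀ e, lucasV P (-1) k ∣ lucasV P (-1) (2 * k + e) + lucasV P (-1) e := fun e => by
    have h := lucasV_add_mul P k e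
    rw [hk.neg_one_pow, one_mul] at h
    exact h ▸ dvd_mul_left _ _
  obtain ⟨v, rfl⟩ := hu
  induction v with
  | zero => simpa using step d
  | succ v ih =>
    have e1 := step (2 * k * (2 * v + 1) + d)
    have e2 := step (2 * k + (2 * k * (2 * v + 1) + d))
    rw [show 2 * k * (2 * (v + 1) + 1) + d = 2 * k + (2 * k + (2 * k * (2 * v + 1) + d)) by ring]
    obtain ⟨a, e1⟩ := e1
    obtain ⟨b, e2⟩ := e2
    obtain ⟨c, ih⟩ := ih
    exact ⟨b - a + c, by linear_combination e2 - e1 + ih⟩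

theorem lucasV_dvd_add_of_eq_or {P : ℤ} {k u a n : ℕ} (hk : Even k) (hu : Odd u) (ha : Even a)
    (h : n = 2 * k * u + a ∨ n + a = 2 * k * u) :
    lucasV P (-1) k ∣ lucasV P (-1) n + lucasV P (-1) a := by
  obtain ⟨c, e1⟩ := lucasV_dvd_add (P := P) hk hu a
  rcases h with rfl | h
  · exact ⟨c, e1⟩
  obtain ⟨d, e2⟩ := lucasV_dvd_add (P := P) hk hu 0
  have e3 := lucasV_add_mul P a n
  rw [ha.neg_one_pow, one_mul, show 2 * a + n = n + a + a by ring, add_comm a n, h] at e3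
  simp only [add_zero, lucasV] at e2
  exact ⟨d * lucasV P (-1) a - c, by linear_combination e3 + lucasV P (-1) a * e2 - e1⟩

/-! ### Iterates of `x ↦ 2 * x ^ 2 - 1` -/

/-- The iterates of `x ↦ 2 * x ^ 2 - 1` starting from `a`. -/
def duplicate (a : ℤ) : ℕ → ℤ
  | 0 => a
  | n + 1 => 2 * duplicate a n ^ 2 - 1

theorem duplicate_pos {a : ℤ} (ha : 0 < a) (i : ℕ) : 0 < duplicate a i := by
  induction i with
  | zero => exact ha
  | succ i ih =>
    simp only [duplicate]
    nlinarith

theorem lucasV_mul_two_pow {P a : ℤ} {k : ℕ} (hk : Even k) (h : lucasV P (-1) k = 2 * a)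
    (i : ℕ) : lucasV P (-1) (k * 2 ^ i) = 2 * duplicate a i := by
  induction i with
  | zero => simpa [duplicate] using h
  | succ i ih =>
    rw [show k * 2 ^ (i + 1) = 2 * (k * 2 ^ i) by ring, lucasV_two_mul, ih,
      (hk.mul_right _).neg_one_pow]
    simp only [duplicate]
    ring

theorem duplicate_modEq_add {M a : ℤ} {s p : ℕ}
    (h : duplicate a (s + p) ≡ duplicate a s [ZMOD M]) (i q : ℕ) :
    duplicate a (s + i + p * q) ≡ duplicate a (s + i) [ZMOD M] := by
  have step : ∀ j, duplicate a (s + j + p) ≡ duplicate a (s + j) [ZMOD M] := fun j => by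
    induction j with
    | zero => exact h
    | succ j ih =>
      rw [show s + (j + 1) + p = s + j + p + 1 by ring, ← add_assoc s j 1]
      simp only [duplicate]
      exact ((ih.pow 2).mul_left 2).sub_right 1
  induction q with
  | zero => rfl
  | succ q ih =>
    rw [show s + i + p * (q + 1) = s + (i + p * q) + p by ring]
    exact (step _).trans (by rwa [← add_assoc])

/-- If `J(a | N) = -1` then `a` is not a square modulo `N`; here the symbol is computed
from the residue of `N` modulo `4 * |a|`. -/
theorem not_dvd_sq_sub {a M N : ℤ} {r : ℕ} (hN : 0 < N) (hM : (4 * a.natAbs : ℕ) = M)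
    (hr : N % M = r) (hro : Odd r) (hJ : jacobiSym a r = -1) (w : ℤ) : ¬ N ∣ w ^ 2 - a := by
  intro h
  lift N to ℕ using hN.le
  subst hM
  norm_cast at hr
  have hodd : Odd N := by
    rw [Nat.odd_iff] at hro ⊢
    rw [← hro, ← hr, Nat.mod_mod_of_dvd _ ⟨2 * a.natAbs, by ring⟩]
  have h1 : jacobiSym a N = -1 := by
    rw [jacobiSym.mod_right a hodd, hr, hJ]
  have h2 : jacobiSym (w ^ 2) N = -1 := by
    rw [← h1]
    exact jacobiSym.mod_left' (Int.ModEq.symm ((Int.modEq_iff_dvd).2 h))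
  rw [jacobiSym.pow_left] at h2
  nlinarith [sq_nonneg (jacobiSym w N)]

/-! ### Common terms with odd indices -/

theorem sq_ne_two_mul_lucasV_sub {k u a n r : ℕ} {M N b : ℤ} (hk : Even k) (hu : Odd u)
    (ha : Even a) (hn : n = 2 * k * u + a ∨ n + a = 2 * k * u)
    (hV : lucasV 1 (-1) k = 2 * N) (hb : -5 - 2 * lucasV 1 (-1) a = b) (hN : 0 < N)
    (hM : (4 * b.natAbs : ℕ) = M) (hr : N % M = r) (hro : Odd r) (hJ : jacobiSym b r = -1) (w : ℤ) :
    w ^ 2 ≠ 2 * lucasV 1 (-1) n - 5 := by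
  intro hw
  obtain ⟨c, hc⟩ := lucasV_dvd_add_of_eq_or (P := 1) hk hu ha hn
  rw [hV] at hc
  exact not_dvd_sq_sub hN hM hr hro hJ w ⟨4 * c, by linear_combination hw + 2 * hc + hb⟩

theorem lucasV_one_six : lucasV 1 (-1) 6 = 2 * 9 := by rfl

theorem lucasV_one_eighteen : lucasV 1 (-1) 18 = 2 * 2889 := by rfl

theorem lucasV_one_fifty_four : lucasV 1 (-1) 54 = 2 * 96450076809 := by decide +kernel

theorem eq_zero_of_index_near_one {m j : ℕ} {w : ℤ} (hm : m = 18 * j + 1 ∨ m + 1 = 18 * j)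
    (hw : w ^ 2 = 2 * lucasV 1 (-1) (2 * m) - 5) : j = 0 := by
  by_contra hj
  obtain ⟨i, u, hu, rfl⟩ := Nat.exists_eq_two_pow_mul_odd hj
  obtain ⟨q, rfl | rfl⟩ : ∃ q, i = 0 + 0 + 2 * q ∨ i = 0 + 1 + 2 * q := ⟨i / 2, by omega⟩
  · have hr : duplicate 2889 (0 + 0 + 2 * q) % 44 = 29 :=
      duplicate_modEq_add (M := 44) (by rfl) 0 q
    exact sq_ne_two_mul_lucasV_sub (a := 2) (b := -11) (r := 29) (Even.mul_right (by decide) _) hu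
      (by decide) (by grind) (lucasV_mul_two_pow (by decide) lucasV_one_eighteen _) (by rfl)
      (duplicate_pos (by norm_num) _) (by rfl) hr (by decide) (by norm_num) w hw
  · have hr : duplicate 9 (0 + 1 + 2 * q) % 44 = 29 :=
      duplicate_modEq_add (M := 44) (by rfl) 1 q
    exact sq_ne_two_mul_lucasV_sub (u := 3 * u) (a := 2) (b := -11) (r := 29)
      (Even.mul_right (by decide) _) (Odd.mul (by decide) hu)
      (by decide) (by grind) (lucasV_mul_two_pow (by decide) lucasV_one_six _) (by rfl)
      (duplicate_pos (by norm_num) _) (by rfl) hr (by decide) (by norm_num) w hw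

theorem eq_zero_of_index_near_seven {m j : ℕ} {w : ℤ} (hm : m = 54 * j + 7 ∨ m + 7 = 54 * j)
    (hw : w ^ 2 = 2 * lucasV 1 (-1) (2 * m) - 5) : j = 0 := by
  by_contra hj
  obtain ⟨i, u, hu, rfl⟩ := Nat.exists_eq_two_pow_mul_odd hj
  have key : ∀ {k v : ℕ} {N : ℤ}, Even k → Odd v → k * v = 54 * u → lucasV 1 (-1) k = 2 * N →
      0 < N → ∀ r : ℕ, duplicate N i % 6764 = r → Odd r → jacobiSym (-1691) r = -1 → False := by
    intro k v N hk hv hkv hV hN r hr hro hJ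
    have hku : 2 * (k * 2 ^ i) * v = 2 * (54 * (2 ^ i * u)) := by linear_combination 2 * 2 ^ i * hkv
    exact sq_ne_two_mul_lucasV_sub (a := 14) (b := -1691) (hk.mul_right _) hv
      (by decide) (by omega) (lucasV_mul_two_pow hk hV i) (by rfl)
      (duplicate_pos hN _) (by rfl) hr hro hJ w hw
  have key6 := key (k := 6) (v := 9 * u) (by decide) (Odd.mul (by decide) hu) (by ring)
    lucasV_one_six (by norm_num)
  have key18 := key (k := 18) (v := 3 * u) (by decide) (Odd.mul (by decide) hu) (by ring)
    lucasV_one_eighteen (by norm_num)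
  have key54 := key (k := 54) (by decide) hu rfl lucasV_one_fifty_four (by norm_num)
  clear key hw hm hj
  obtain ⟨q, rfl | rfl | rfl | rfl | rfl | rfl⟩ : ∃ q, i = 0 ∨ i = 1 + 0 + 5 * q ∨
      i = 1 + 1 + 5 * q ∨ i = 1 + 2 + 5 * q ∨ i = 1 + 3 + 5 * q ∨ i = 1 + 4 + 5 * q :=
    ⟨(i - 1) / 5, by omega⟩
  · exact key18 2889 (by rfl) (by decide) (by norm_num)
  · exact key54 2357 (duplicate_modEq_add (M := 6764) (by rfl) 0 q) (by decide)
      (by norm_num)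
  · exact key6 4493 (duplicate_modEq_add (M := 6764) (by rfl) 1 q) (by decide)
      (by norm_num)
  · exact key6 6545 (duplicate_modEq_add (M := 6764) (by rfl) 2 q) (by decide)
      (by norm_num)
  · exact key18 2357 (duplicate_modEq_add (M := 6764) (by rfl) 3 q) (by decide)
      (by norm_num)
  · exact key18 4409 (duplicate_modEq_add (M := 6764) (by rfl) 4 q) (by decide)
      (by norm_num)

/-! ### Periodicity -/

theorem modEq_mod_of_recurrence {f : ℕ → ℤ} {P Q M : ℤ} {p : ℕ}
    (hf : ∀ n, f (n + 2) = P * f (n + 1) - Q * f n)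
    (h0 : f p ≡ f 0 [ZMOD M]) (h1 : f (p + 1) ≡ f 1 [ZMOD M]) (n : ℕ) :
    f n ≡ f (n % p) [ZMOD M] := by
  have step : ∀ n, f (n + p) ≡ f n [ZMOD M] := fun n => by
    induction n using Nat.twoStepInduction with
    | zero => simpa using h0
    | one => simpa [add_comm] using h1
    | more n e0 e1 =>
      rw [show n + 2 + p = n + p + 2 by ring, hf, hf]
      rw [show n + 1 + p = n + p + 1 by ring] at e1
      exact (e1.mul_left P).sub (e0.mul_left Q)
  have steps : ∀ q, f (n % p + p * q) ≡ f (n % p) [ZMOD M] := fun q => by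
    induction q with
    | zero => rfl
    | succ q ih =>
      rw [mul_add_one, ← add_assoc]
      exact (step _).trans ih
  simpa [Nat.mod_add_div] using steps (n / p)

theorem lucasU_modEq_mod {P Q M : ℤ} {p : ℕ} (h0 : lucasU P Q p ≡ 0 [ZMOD M])
    (h1 : lucasU P Q (p + 1) ≡ 1 [ZMOD M]) (n : ℕ) :
    lucasU P Q n ≡ lucasU P Q (n % p) [ZMOD M] :=
  modEq_mod_of_recurrence (fun _ => rfl) h0 h1 n

theorem lucasV_modEq_mod {P Q M : ℤ} {p : ℕ} (h0 : lucasV P Q p ≡ 2 [ZMOD M])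
    (h1 : lucasV P Q (p + 1) ≡ P [ZMOD M]) (n : ℕ) :
    lucasV P Q n ≡ lucasV P Q (n % p) [ZMOD M] :=
  modEq_mod_of_recurrence (fun _ => rfl) h0 h1 n

theorem exists_lt_dvd_sq_sub {p : ℕ} (hp : 0 < p) {w x y : ℤ} (hxy : x ≡ y [ZMOD p])
    (hw : w ^ 2 = 2 * x ^ 2 - 1) : ∃ a ∈ Finset.range p, (p : ℤ) ∣ (a : ℤ) ^ 2 - (2 * y ^ 2 - 1) := by
  have hp0 : (p : ℤ) ≠ 0 := by omega
  have hnn := Int.emod_nonneg w hp0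
  have hlt := Int.emod_lt_of_pos w (by omega : (0 : ℤ) < p)
  refine ⟨(w % p).toNat, Finset.mem_range.mpr (by omega), ?_⟩
  rw [Int.toNat_of_nonneg hnn]
  refine Int.ModEq.dvd (Int.ModEq.symm ?_)
  calc (w % p) ^ 2 ≡ w ^ 2 [ZMOD p] := (Int.mod_modEq w p).pow 2
    _ ≡ 2 * y ^ 2 - 1 [ZMOD p] := hw ▸ ((hxy.pow 2).mul_left 2).sub_right 1

set_option synthInstance.maxSize 2000 in
theorem index_sieve : ∀ r < 108, r % 2 = 1 →
    (∃ a ∈ Finset.range 17, ((17 : ℕ) : ℤ) ∣ (a : ℤ) ^ 2 - (2 * lucasV 1 (-1) r ^ 2 - 1)) →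
    (∃ a ∈ Finset.range 19, ((19 : ℕ) : ℤ) ∣ (a : ℤ) ^ 2 - (2 * lucasV 1 (-1) r ^ 2 - 1)) →
    (∃ a ∈ Finset.range 53, ((53 : ℕ) : ℤ) ∣ (a : ℤ) ^ 2 - (2 * lucasV 1 (-1) r ^ 2 - 1)) →
    r % 18 = 1 ∨ r % 18 = 17 ∨ r % 54 = 7 ∨ r % 54 = 47 := by
  decide +kernel

theorem eq_one_or_eq_seven_of_sq {m : ℕ} (hm : Odd m) {w : ℤ}
    (hw : w ^ 2 = 2 * lucasV 1 (-1) m ^ 2 - 1) : m = 1 ∨ m = 7 := by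
  have hw2 : w ^ 2 = 2 * lucasV 1 (-1) (2 * m) - 5 := by
    rw [hw, lucasV_two_mul, hm.neg_one_pow]
    ring
  have hodd := Nat.odd_iff.mp hm
  rcases index_sieve (m % 108) (by omega) (by omega)
    (exists_lt_dvd_sq_sub (by norm_num) (lucasV_modEq_mod (by decide +kernel) (by decide +kernel) m) hw)
    (exists_lt_dvd_sq_sub (by norm_num) (lucasV_modEq_mod (by decide +kernel) (by decide +kernel) m) hw)
    (exists_lt_dvd_sq_sub (by norm_num) (lucasV_modEq_mod (by decide +kernel) (by decide +kernel) m) hw)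
    with h | h | h | h
  · have := eq_zero_of_index_near_one (j := m / 18) (by omega) hw2
    omega
  · have := eq_zero_of_index_near_one (j := (m + 1) / 18) (by omega) hw2
    omega
  · have := eq_zero_of_index_near_seven (j := m / 54) (by omega) hw2
    omega
  · have := eq_zero_of_index_near_seven (j := (m + 7) / 54) (by omega) hw2
    omega

/-! ### Common terms with even indices -/

theorem eq_zero_of_index_near_two {n j : ℕ} {f : ℤ} (hn : n = 8 * j + 2 ∨ n + 2 = 8 * j)
    (hf : lucasV 2 (-1) (2 * n) = 40 * f ^ 2 + 34) : j = 0 := by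
  by_contra hj
  obtain ⟨i, u, hu, rfl⟩ := Nat.exists_eq_two_pow_mul_odd hj
  obtain ⟨c, hc⟩ := lucasV_dvd_add_of_eq_or (P := 2) (k := 8 * 2 ^ i) (u := u) (a := 4) (n := 2 * n)
    (Even.mul_right (by decide) _) hu (by decide) (by grind)
  rw [hf, lucasV_mul_two_pow (a := 577) (by decide) (by rfl), show lucasV 2 (-1) 4 = 34 by rfl]
    at hc
  have hdvd : duplicate 577 i ∣ (10 * f) ^ 2 - (-170) := ⟨5 * c, by linarith⟩
  have hpos : 0 < duplicate 577 i := duplicate_pos (by norm_num) i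
  obtain rfl | ⟨q, rfl⟩ : i = 0 ∨ ∃ q, i = 1 + 0 + 1 * q := by
    rcases i with _ | q
    · exact .inl rfl
    · exact .inr ⟨q, by ring⟩
  · exact not_dvd_sq_sub (r := 577) hpos (M := 680) (by rfl) (by rfl) (by decide) (by norm_num) _ hdvd
  · exact not_dvd_sq_sub (r := 137) hpos (by rfl) (duplicate_modEq_add (M := 680) (by rfl) 0 q)
      (by decide) (by norm_num) _ hdvd

/-! ### Congruences relating the parities of the indices -/

theorem index_parity_mod_four : ∀ r < 4, ∀ s < 6,
    lucasU 2 (-1) r % 4 = lucasV 1 (-1) s % 4 → s % 2 = 0 → r = 2 := by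
  decide +kernel

theorem index_parity_mod_five : ∀ r < 12, ∀ s < 4,
    lucasU 2 (-1) r % 5 = lucasV 1 (-1) s % 5 → s % 2 = 1 → r % 2 = 1 := by
  decide +kernel

theorem lucasU_two_eq_lucasV_one {n m : ℕ} (h : lucasU 2 (-1) n = lucasV 1 (-1) m) :
    n = 2 ∨ m = 1 ∨ m = 7 := by
  have hU := lucasU_norm 2 n
  have hU2 := lucasV_sq_sub 2 n
  have hV := lucasV_sq_sub 1 m
  rcases Nat.even_or_odd m with hm | hm
  · have h4 : n % 4 = 2 := by
      refine index_parity_mod_four _ (by omega) (m % 6) (by omega) ?_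
        (by have := Nat.even_iff.mp hm; omega)
      calc lucasU 2 (-1) (n % 4) ≡ lucasU 2 (-1) n [ZMOD 4] :=
            (lucasU_modEq_mod (by rfl) (by rfl) n).symm
        _ = lucasV 1 (-1) m := h
        _ ≡ lucasV 1 (-1) (m % 6) [ZMOD 4] := lucasV_modEq_mod (by rfl) (by rfl) m
    have hn : Even n := Nat.even_iff.mpr (by omega)
    have hf : lucasV 2 (-1) (2 * n) = 40 * lucasU 1 (-1) m ^ 2 + 34 := by
      rw [lucasV_two_mul, hn.neg_one_pow]
      rw [hn.neg_one_pow, h] at hU2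
      rw [hm.neg_one_pow] at hV
      linear_combination hU2 + 8 * hV
    left
    rcases (by omega : n % 8 = 2 ∨ n % 8 = 6) with h8 | h8
    · have := eq_zero_of_index_near_two (j := n / 8) (by omega) hf
      omega
    · have := eq_zero_of_index_near_two (j := (n + 2) / 8) (by omega) hf
      omega
  · have h2 : n % 12 % 2 = 1 := by
      refine index_parity_mod_five _ (by omega) (m % 4) (by omega) ?_
        (by have := Nat.odd_iff.mp hm; omega)
      calc lucasU 2 (-1) (n % 12) ≡ lucasU 2 (-1) n [ZMOD 5] :=
            (lucasU_modEq_mod (by rfl) (by rfl) n).symm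
        _ = lucasV 1 (-1) m := h
        _ ≡ lucasV 1 (-1) (m % 4) [ZMOD 5] := lucasV_modEq_mod (by rfl) (by rfl) m
    have hn : Odd n := Nat.odd_iff.mpr (by omega)
    rw [hn.neg_one_pow] at hU
    refine .inr (eq_one_or_eq_seven_of_sq hm
      (w := lucasU 2 (-1) (n + 1) - lucasU 2 (-1) n) ?_)
    rw [← h]
    linear_combination hU

theorem pell_inter_lucas :
    {x : ℤ | ∃ n : ℕ, x = lucasU 2 (-1) n} ∩ {x : ℤ | ∃ m : ℕ, x = lucasV 1 (-1) m} =
      ({1, 2, 29} : Set ℤ) := by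
  ext x
  simp only [Set.mem_inter_iff, Set.mem_ofPred_eq, Set.mem_insert_iff, Set.mem_singleton_iff]
  constructor
  · rintro ⟨⟨n, hn⟩, m, hm⟩
    rcases lucasU_two_eq_lucasV_one (hn.symm.trans hm) with rfl | rfl | rfl
    · exact .inr (.inl hn)
    · exact .inl hm
    · exact .inr (.inr hm)
  · rintro (rfl | rfl | rfl)
    · exact ⟨⟨1, rfl⟩, 1, rfl⟩
    · exact ⟨⟨2, rfl⟩, 0, rfl⟩
    · exact ⟨⟨5, rfl⟩, 7, rfl⟩
end
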